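/- arXiv:1304.3479 — 2 statements merged into one kernel-verified Lean document; each statement's English description precedes it below -/
import Mathlib

section
/- Let r > 0 and let V : ℝ^p → ℝ be continuous on the closed ball B̄_r = {z : ‖z‖ ≤ r} with V(0) = 0 and V(z) > 0 for all z ∈ B̄_r with z ≠ 0 (V is positive definite on B̄_r). Then there exist class 𝒦 functions α₁, α₂ : [0,r] → [0,∞) such that α₁(‖z‖) ≤ V(z) ≤ α₂(‖z‖) for all z ∈ B̄_r. -/
open Set

/-- `α : [0,b] → [0,∞)` is a class 𝒦 function: continuous, strictly increasing,
nonnegative, with `α 0 = 0`. -/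
def IsClassK (b : ℝ) (α : ℝ → ℝ) : Prop :=
  ContinuousOn α (Icc 0 b) ∧ StrictMonoOn α (Icc 0 b) ∧ α 0 = 0 ∧
    ∀ x ∈ Icc 0 b, 0 ≤ α x

open Metric

lemma exists_continuous_eqOn_closedBall {p : ℕ} {r : ℝ}
    {V : EuclideanSpace ℝ (Fin p) → ℝ} (hV : ContinuousOn V (closedBall 0 r)) :
    ∃ W : EuclideanSpace ℝ (Fin p) → ℝ, Continuous W ∧ EqOn W V (closedBall 0 r) := by
  obtain ⟨W, hW⟩ := ContinuousMap.exists_restrict_eq isClosed_closedBall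
    ⟨(closedBall 0 r).domRestrict V, hV.domRestrict⟩
  exact ⟨W, W.continuous, fun z hz => DFunLike.congr_fun hW ⟨z, hz⟩⟩

/-- The running maximum `s ↦ max_{‖z‖ ≤ s} W z`, made strictly increasing by adding `s`. -/
lemma exists_isClassK_ge {p : ℕ} (r : ℝ) {W : EuclideanSpace ℝ (Fin p) → ℝ}
    (hW : Continuous W) (hW0 : W 0 = 0) :
    ∃ α : ℝ → ℝ, IsClassK r α ∧ ∀ z, W z ≤ α ‖z‖ := by
  set B : Set (EuclideanSpace ℝ (Fin p)) := closedBall 0 1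
  have hB : IsCompact B := isCompact_closedBall 0 1
  have hBne : B.Nonempty := ⟨0, by simp [B]⟩
  set h : ℝ → ℝ := fun s => sSup ((fun u => W (s • u)) '' B)
  have hcont : Continuous h :=
    hB.continuous_sSup (f := fun s u => W (s • u)) (by fun_prop)
  have le_h (s : ℝ) {u : EuclideanSpace ℝ (Fin p)} (hu : u ∈ B) : W (s • u) ≤ h s :=
    le_csSup (hB.bddAbove_image (by fun_prop)) ⟨u, hu, rfl⟩
  have le_h_norm (z : EuclideanSpace ℝ (Fin p)) : W z ≤ h ‖z‖ := by
    rcases eq_or_ne z 0 with rfl | hz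
    · simpa using le_h ‖(0 : EuclideanSpace ℝ (Fin p))‖ (u := 0) (by simp [B])
    · have hz' : ‖z‖ ≠ 0 := norm_ne_zero_iff.2 hz
      simpa [smul_smul, hz'] using
        le_h ‖z‖ (u := ‖z‖⁻¹ • z) (by simp [B, norm_smul, hz'])
  have h0 : h 0 = 0 := by simp [h, hW0, hBne.image_const]
  have hmono : MonotoneOn h (Ici 0) := by
    intro s hs t ht hst
    refine csSup_le (hBne.image _) ?_
    rintro _ ⟨u, hu, rfl⟩
    rcases (mem_Ici.1 ht).eq_or_lt with rfl | htpos
    · rw [le_antisymm hst hs]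
      exact le_h 0 hu
    · have hu1 : ‖u‖ ≤ 1 := by simpa [B] using hu
      have hmem : (s / t) • u ∈ B := by
        rw [mem_closedBall_zero_iff, norm_smul, Real.norm_of_nonneg (div_nonneg hs ht)]
        exact mul_le_one₀ ((div_le_one htpos).2 hst) (norm_nonneg _) hu1
      simpa [smul_smul, mul_div_cancel₀ s htpos.ne'] using le_h t hmem
  have hnonneg {s : ℝ} (hs : 0 ≤ s) : 0 ≤ h s := h0 ▸ hmono self_mem_Ici hs hs
  refine ⟨fun s => s + h s, ⟨(continuous_id.add hcont).continuousOn, ?_, by simp [h0], ?_⟩, ?_⟩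
  · exact fun s hs t ht hst => add_lt_add_of_lt_of_le hst (hmono hs.1 ht.1 hst.le)
  · exact fun s hs => add_nonneg hs.1 (hnonneg hs.1)
  · exact fun z => (le_h_norm z).trans (le_add_of_nonneg_left (norm_nonneg z))

/-- The regularized minimum `s ↦ min_w (W w + max 0 (s - ‖w‖))`, made strictly increasing by
the factor `s / r`. -/
lemma exists_isClassK_le {p : ℕ} {r : ℝ} (hr : 0 < r) {W : EuclideanSpace ℝ (Fin p) → ℝ}
    (hW : Continuous W) (hW0 : W 0 = 0) (hWpos : ∀ z ∈ closedBall 0 r, z ≠ 0 → 0 < W z) :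
    ∃ α : ℝ → ℝ, IsClassK r α ∧ ∀ z, ‖z‖ ≤ r → α ‖z‖ ≤ W z := by
  set B : Set (EuclideanSpace ℝ (Fin p)) := closedBall 0 r
  have hB : IsCompact B := isCompact_closedBall 0 r
  have hBne : B.Nonempty := ⟨0, by simp [B, hr.le]⟩
  set f : ℝ → EuclideanSpace ℝ (Fin p) → ℝ := fun s w => W w + max 0 (s - ‖w‖)
  have hf (s : ℝ) : Continuous (f s) := by fun_prop
  set g : ℝ → ℝ := fun s => sInf (f s '' B)
  have hcont : Continuous g := hB.continuous_sInf (f := f) (by fun_prop)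
  have g_le (s : ℝ) {w : EuclideanSpace ℝ (Fin p)} (hw : w ∈ B) : g s ≤ f s w :=
    csInf_le (hB.bddBelow_image (hf s).continuousOn) ⟨w, hw, rfl⟩
  have hmono : Monotone g := by
    intro s t hst
    refine le_csInf (hBne.image _) ?_
    rintro _ ⟨w, hw, rfl⟩
    refine (g_le s hw).trans ?_
    dsimp only [f]
    gcongr
  have hpos {s : ℝ} (hs : 0 < s) : 0 < g s := by
    obtain ⟨w, hw, hgw⟩ := hB.exists_sInf_image_eq hBne (hf s).continuousOn
    change 0 < sInf (f s '' B)
    rw [hgw]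
    rcases eq_or_ne w 0 with rfl | hw0
    · simpa [f, hW0] using hs
    · exact add_pos_of_pos_of_nonneg (hWpos w hw hw0) (le_max_left _ _)
  have hnonneg {s : ℝ} (hs : 0 ≤ s) : 0 ≤ s / r * g s := by
    rcases hs.eq_or_lt with rfl | hs
    · simp
    · exact mul_nonneg (div_nonneg hs.le hr.le) (hpos hs).le
  refine ⟨fun s => s / r * g s, ⟨Continuous.continuousOn (by fun_prop), ?_, by simp,
    fun s hs => hnonneg hs.1⟩, ?_⟩
  · intro s hs t ht hst
    have htpos : 0 < t := hs.1.trans_lt hst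
    calc s / r * g s ≤ s / r * g t :=
          mul_le_mul_of_nonneg_left (hmono hst.le) (div_nonneg hs.1 hr.le)
      _ < t / r * g t :=
          mul_lt_mul_of_pos_right (div_lt_div_of_pos_right hst hr) (hpos htpos)
  · intro z hz
    rcases eq_or_ne z 0 with rfl | hz0
    · simp [hW0]
    · calc ‖z‖ / r * g ‖z‖ ≤ g ‖z‖ :=
            mul_le_of_le_one_left (hpos (norm_pos_iff.2 hz0)).le ((div_le_one hr).2 hz)
        _ ≤ W z := by simpa [f] using g_le ‖z‖ (w := z) (by simpa [B] using hz)

/-- A continuous positive definite function `V` on a closed ball `B̄_r` is sandwiched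
between two class 𝒦 functions of the norm: there exist class 𝒦 functions
`α₁, α₂ : [0,r] → [0,∞)` with `α₁(‖z‖) ≤ V(z) ≤ α₂(‖z‖)` on `B̄_r`. -/
theorem posdef_sandwiched_by_classK
    (p : ℕ) (r : ℝ) (hr : 0 < r)
    (V : EuclideanSpace ℝ (Fin p) → ℝ)
    (hVcont : ContinuousOn V (Metric.closedBall 0 r))
    (hV0 : V 0 = 0)
    (hVpos : ∀ z ∈ Metric.closedBall (0 : EuclideanSpace ℝ (Fin p)) r, z ≠ 0 → 0 < V z) :
    ∃ α₁ α₂ : ℝ → ℝ, IsClassK r α₁ ∧ IsClassK r α₂ ∧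
      ∀ z : EuclideanSpace ℝ (Fin p), ‖z‖ ≤ r → α₁ ‖z‖ ≤ V z ∧ V z ≤ α₂ ‖z‖ := by
  obtain ⟨W, hW, hWV⟩ := exists_continuous_eqOn_closedBall hVcont
  have hW0 : W 0 = 0 := (hWV (Metric.mem_closedBall_self hr.le)).trans hV0
  obtain ⟨α₁, hα₁, hle⟩ := exists_isClassK_le hr hW hW0
    (fun z hz hz0 => (hWV hz).symm ▸ hVpos z hz hz0)
  obtain ⟨α₂, hα₂, hge⟩ := exists_isClassK_ge r hW hW0
  refine ⟨α₁, α₂, hα₁, hα₂, fun z hz => ?_⟩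
  rw [← hWV (mem_closedBall_zero_iff.2 hz)]
  exact ⟨hle z hz, hge z⟩
end

section
/- Let N agents have states x_i : [t₀,∞) → ℝⁿ with local neighborhood tracking errors e_i(t) = Σ_{j=1}^N a_{ij}(x_i(t) − x_j(t)) + a_{i0} x_i(t), and suppose s > 0 satisfies s‖v‖ ≤ ‖(ℒ + 𝒜₀)v‖ for all v ∈ ℝ^N. If there are constants ρ_1,…,ρ_N ≥ 0 with ‖e_i(t)‖ ≤ ρ_i for all t ≥ t₀ and all i, then for every t ≥ t₀ and every i, ‖x_i(t)‖ ≤ (Σ_{k=1}^N ρ_k)/s; i.e., all agent trajectories remain in the compact set S = {x ∈ ℝⁿ : ‖x‖ ≤ S̄} with S̄ = (Σ_{k=1}^N ρ_k)/s. -/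
open Matrix Finset

/-- A lower bound `s` for a real matrix on Euclidean space is also a lower bound for its
blockwise action on families of vectors. -/
lemma sq_mul_sum_norm_sq_le_of_mulVec {ι κ : Type*} [Fintype ι] [Fintype κ]
    (M : Matrix ι ι ℝ) {s : ℝ} (hs : 0 ≤ s)
    (hM : ∀ v : EuclideanSpace ℝ ι, s * ‖v‖ ≤ ‖WithLp.toLp 2 (M *ᵥ v.ofLp)‖)
    (y : ι → EuclideanSpace ℝ κ) :
    s ^ 2 * ∑ i, ‖y i‖ ^ 2 ≤ ∑ i, ‖∑ j, M i j • y j‖ ^ 2 := by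
  simp only [EuclideanSpace.real_norm_sq_eq]
  rw [Finset.sum_comm, Finset.sum_comm (s := (Finset.univ : Finset ι)), Finset.mul_sum]
  refine Finset.sum_le_sum fun c _ => ?_
  have h := pow_le_pow_left₀ (by positivity) (hM (WithLp.toLp 2 fun i => y i c)) 2
  rw [mul_pow, EuclideanSpace.real_norm_sq_eq, EuclideanSpace.real_norm_sq_eq] at h
  simpa [Matrix.mulVec, dotProduct] using h

/-- The pinned graph Laplacian maps the states to the local neighborhood tracking errors. -/
lemma sum_pinnedLaplacian_smul {ι E : Type*} [Fintype ι] [DecidableEq ι]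
    [AddCommGroup E] [Module ℝ E] (a : ι → ι → ℝ) (a0 : ι → ℝ) (y : ι → E) (i : ι) :
    ∑ j, (Matrix.diagonal (fun i => ∑ j, a i j) - Matrix.of a + Matrix.diagonal a0) i j • y j =
      (∑ j, a i j • (y i - y j)) + a0 i • y i := by
  simp [Matrix.diagonal_apply, add_smul, sub_smul, smul_sub, Finset.sum_add_distrib,
    Finset.sum_sub_distrib, ite_smul, Finset.sum_smul]

/-- If each local neighborhood tracking error trajectory is bounded, `‖e_i(t)‖ ≤ ρ_i`,
and `s > 0` is a lower bound on the singular values of `ℒ + 𝒜₀`, then every agent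
trajectory stays in the compact set `{x : ‖x‖ ≤ (∑ k ρ_k)/s}`. -/
theorem trajectories_in_compact_set
    (N n : ℕ)
    (a : Fin N → Fin N → ℝ) (a0 : Fin N → ℝ)
    (ha : ∀ i j, 0 ≤ a i j) (hdiag : ∀ i, a i i = 0) (ha0 : ∀ i, 0 ≤ a0 i)
    (t₀ : ℝ)
    (x : Fin N → ℝ → EuclideanSpace ℝ (Fin n))
    (e : Fin N → ℝ → EuclideanSpace ℝ (Fin n))
    (he : ∀ i t, e i t = (∑ j, a i j • (x i t - x j t)) + a0 i • x i t)
    (L A0 : Matrix (Fin N) (Fin N) ℝ)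
    (hL : L = Matrix.diagonal (fun i => ∑ j, a i j) - Matrix.of a)
    (hA0 : A0 = Matrix.diagonal a0)
    (s : ℝ) (hs : 0 < s)
    (hmin : ∀ v : EuclideanSpace ℝ (Fin N),
      s * ‖v‖ ≤ ‖(WithLp.equiv 2 (Fin N → ℝ)).symm
        ((L + A0).mulVec ((WithLp.equiv 2 (Fin N → ℝ)) v))‖)
    (ρ : Fin N → ℝ) (hρ : ∀ i, 0 ≤ ρ i)
    (hebound : ∀ i, ∀ t, t₀ ≤ t → ‖e i t‖ ≤ ρ i) :
    ∀ t, t₀ ≤ t → ∀ i, ‖x i t‖ ≤ (∑ k, ρ k) / s := by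
  intro t ht i
  subst hL hA0
  have h := sq_mul_sum_norm_sq_le_of_mulVec _ hs.le hmin (fun j => x j t)
  simp only [sum_pinnedLaplacian_smul, ← he] at h
  have hi : ‖x i t‖ ^ 2 ≤ ∑ j, ‖x j t‖ ^ 2 :=
    Finset.single_le_sum (f := fun j => ‖x j t‖ ^ 2) (fun _ _ => sq_nonneg _)
      (Finset.mem_univ i)
  have hsq : ∑ j, ‖e j t‖ ^ 2 ≤ (∑ k, ρ k) ^ 2 :=
    (Finset.sum_le_sum fun j _ =>
      pow_le_pow_left₀ (norm_nonneg _) (hebound j t ht) 2).trans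
      (Finset.sum_sq_le_sq_sum_of_nonneg fun j _ => hρ j)
  rw [le_div_iff₀ hs]
  refine le_of_abs_le (abs_le_of_sq_le_sq ?_ (Finset.sum_nonneg fun k _ => hρ k))
  calc (‖x i t‖ * s) ^ 2 = s ^ 2 * ‖x i t‖ ^ 2 := by ring
    _ ≤ s ^ 2 * ∑ j, ‖x j t‖ ^ 2 := by gcongr
    _ ≤ (∑ k, ρ k) ^ 2 := h.trans hsq
end
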